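/- arXiv:2203.16471 — 2 statements merged into one kernel-verified Lean document; each statement's English description precedes it below -/
import Mathlib

section
/- Let V be a finite-dimensional real normed vector space and let μ be a (translation-invariant) Haar measure on V. Then every subset A ⊆ V with diam A ≤ 2 satisfies μ(A) ≤ μ(B̄(0,1)), where B̄(0,1) is the closed unit ball of the norm. In other words, the unit ball is an isodiametric set in V. -/
open MeasureTheory
open scoped ENNReal
open scoped Pointwise

/-- Midpoint form of the Prekopa-Leindler inequality for a measure. -/
def PLProp {E : Type*} [AddCommGroup E] [Module ℝ E] [MeasurableSpace E]
    (μ : Measure E) : Prop :=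
  ∀ f g h : E → ℝ≥0∞, Measurable f → Measurable g → Measurable h →
    (∀ x y, f x * g y ≤ h ((1 / 2 : ℝ) • (x + y)) ^ 2) →
    (∫⁻ x, f x ∂μ) * (∫⁻ x, g x ∂μ) ≤ (∫⁻ x, h x ∂μ) ^ 2

theorem bm_compact (K L C : Set ℝ) (hK : IsCompact K) (hL : IsCompact L)
    (hK0 : K.Nonempty) (hL0 : L.Nonempty)
    (hC : ∀ x ∈ K, ∀ y ∈ L, (1 / 2 : ℝ) • (x + y) ∈ C) :
    volume K + volume L ≤ 2 * volume C := by
  obtain ⟨a, haK, ha⟩ := hK.exists_isGreatest hK0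
  obtain ⟨b, hbL, hb⟩ := hL.exists_isLeast hL0
  have h1 : volume ((fun x => x + b) '' K) = volume K := by
    simp
  have h2 : volume ((fun x => a + x) '' L) = volume L := by
    simp
  have hd : AEDisjoint volume ((fun x => x + b) '' K) ((fun x => a + x) '' L) := by
    refine measure_mono_null (t := {a + b}) ?_ (by simp)
    rintro z ⟨⟨x, hx, rfl⟩, ⟨y, hy, hxy⟩⟩
    have := ha hx
    have := hb hy
    simp only [Set.mem_singleton_iff] at *
    linarith
  have hm : NullMeasurableSet ((fun x => a + x) '' L) (volume : Measure ℝ) :=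
    (hL.image (by fun_prop)).measurableSet.nullMeasurableSet
  have h3 : volume ((2 : ℝ) • C) = 2 * volume C := by
    rw [Measure.addHaar_smul]; simp
  rw [← h3, ← h1, ← h2, ← measure_union₀ hm hd]
  apply measure_mono
  rintro z (⟨x, hx, rfl⟩ | ⟨y, hy, rfl⟩)
  · refine ⟨_, hC x hx b hbL, ?_⟩
    simp
  · refine ⟨_, hC a haK y hy, ?_⟩
    simp

theorem bm_real (A B C : Set ℝ) (hA : MeasurableSet A) (hB : MeasurableSet B)
    (hA0 : A.Nonempty) (hB0 : B.Nonempty)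
    (hC : ∀ x ∈ A, ∀ y ∈ B, (1 / 2 : ℝ) • (x + y) ∈ C) :
    volume A + volume B ≤ 2 * volume C := by
  obtain ⟨a, ha⟩ := hA0
  obtain ⟨b, hb⟩ := hB0
  rw [hA.measure_eq_iSup_isCompact, hB.measure_eq_iSup_isCompact]
  simp only [iSup_and']
  refine ENNReal.biSup_add_biSup_le' ⟨∅, by simp⟩ ⟨∅, by simp⟩ ?_
  rintro K ⟨hKA, hK⟩ L ⟨hLB, hL⟩
  refine le_trans (add_le_add (measure_mono (Set.subset_insert a K))
    (measure_mono (Set.subset_insert b L))) ?_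
  apply bm_compact _ _ _ (hK.insert a) (hL.insert b) ⟨a, by simp⟩ ⟨b, by simp⟩
  intro x hx y hy
  exact hC x (Set.insert_subset ha hKA hx) y (Set.insert_subset hb hLB hy)

theorem pl_real_unit (f g h : ℝ → ℝ) (hf : Measurable f) (hg : Measurable g) (hh : Measurable h)
    (f0 : ∀ x, 0 ≤ f x) (g0 : ∀ x, 0 ≤ g x) (h0 : ∀ x, 0 ≤ h x)
    (f1 : ∀ x, f x ≤ 1) (g1 : ∀ x, g x ≤ 1)
    (fs : ∀ t < 1, ∃ x, t < f x) (gs : ∀ t < 1, ∃ x, t < g x)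
    (H : ∀ x y, f x * g y ≤ h ((1 / 2 : ℝ) • (x + y)) ^ 2) :
    (∫⁻ x, ENNReal.ofReal (f x)) + (∫⁻ x, ENNReal.ofReal (g x))
      ≤ 2 * ∫⁻ x, ENNReal.ofReal (h x) := by
  rw [lintegral_eq_lintegral_meas_lt _ (.of_forall f0) hf.aemeasurable,
    lintegral_eq_lintegral_meas_lt _ (.of_forall g0) hg.aemeasurable,
    lintegral_eq_lintegral_meas_lt _ (.of_forall h0) hh.aemeasurable,
    ← lintegral_const_mul' _ _ (by simp)]
  have hfm : Measurable fun t : ℝ => volume {a | t < f a} :=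
    Antitone.measurable fun s t hst => measure_mono fun x hx => lt_of_le_of_lt hst hx
  rw [← lintegral_add_left hfm]
  refine setLIntegral_mono' measurableSet_Ioi fun t ht => ?_
  have ht0 : (0 : ℝ) < t := ht
  by_cases ht1 : t < 1
  · refine bm_real _ _ _ (measurableSet_lt measurable_const hf)
      (measurableSet_lt measurable_const hg) (fs t ht1) (gs t ht1) ?_
    intro x hx y hy
    simp only [Set.mem_ofPred_eq] at hx hy ⊢
    refine lt_of_pow_lt_pow_left₀ 2 (h0 _) (lt_of_lt_of_le ?_ (H x y))
    nlinarith
  · have e1 : {a | t < f a} = ∅ := by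
      ext x; simp; linarith [f1 x]
    have e2 : {a | t < g a} = ∅ := by
      ext x; simp; linarith [g1 x]
    simp [e1, e2]

theorem ennreal_amgm {a b c : ℝ≥0∞} (h : a + b ≤ 2 * c) : a * b ≤ c ^ 2 := by
  by_cases hc : c = ⊤
  · subst hc; simp
  have hab : a + b ≠ ⊤ := ne_top_of_le_ne_top (ENNReal.mul_ne_top (by simp) hc) h
  lift c to NNReal using hc
  lift a to NNReal using (by intro h; simp [h] at hab)
  lift b to NNReal using (by intro h; simp [h] at hab)
  norm_cast at h ⊢
  have h' : (a : ℝ) + b ≤ 2 * c := by exact_mod_cast h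
  have : (a : ℝ) * b ≤ c ^ 2 := by
    nlinarith [sq_nonneg ((a : ℝ) - b), a.2, b.2, c.2, NNReal.coe_nonneg a, NNReal.coe_nonneg b]
  exact_mod_cast this

theorem pl_real_bdd (f g h : ℝ → ℝ≥0∞) (hf : Measurable f) (hg : Measurable g)
    (hh : Measurable h) (fb : ⨆ x, f x ≠ ⊤) (gb : ⨆ x, g x ≠ ⊤)
    (H : ∀ x y, f x * g y ≤ h ((1 / 2 : ℝ) • (x + y)) ^ 2) :
    (∫⁻ x, f x) * (∫⁻ x, g x) ≤ (∫⁻ x, h x) ^ 2 := by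
  have key : ∀ f : ℝ → ℝ≥0∞, Measurable f → ∀ M : ℝ≥0∞, M = ⨆ x, f x → M ≠ ⊤ → M ≠ 0 →
      ∃ φ : ℝ → ℝ, Measurable φ ∧ (∀ x, 0 ≤ φ x) ∧ (∀ x, φ x ≤ 1) ∧ (∀ t < 1, ∃ x, t < φ x) ∧
        (∀ x, ENNReal.ofReal (φ x) = f x / M) := by
    intro f hf M hM hMt hM0
    have hle : ∀ x, f x / M ≤ 1 := fun x =>
      ENNReal.div_le_of_le_mul (by rw [one_mul, hM]; exact le_iSup f x)
    have hnt : ∀ x, f x / M ≠ ⊤ := fun x => ne_top_of_le_ne_top (by simp) (hle x)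
    refine ⟨fun x => (f x / M).toReal, (hf.div_const M).ennreal_toReal, fun x => ENNReal.toReal_nonneg, ?_, ?_, ?_⟩
    · intro x
      exact ENNReal.toReal_le_of_le_ofReal (by simp) (by simpa using hle x)
    · intro t ht
      have : ENNReal.ofReal t * M < M := by
        conv_rhs => rw [← one_mul M]
        exact (ENNReal.mul_lt_mul_iff_left hM0 hMt).2 (by simpa using ht)
      conv_rhs at this => rw [hM]
      obtain ⟨x, hx⟩ := lt_iSup_iff.1 this
      refine ⟨x, ?_⟩
      have h5 : ENNReal.ofReal t < f x / M :=
        (ENNReal.lt_div_iff_mul_lt (Or.inl hM0) (Or.inl hMt)).2 hx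
      rw [← ENNReal.ofReal_toReal (hnt x)] at h5
      exact (ENNReal.ofReal_lt_ofReal_iff'.1 h5).1
    · intro x
      exact ENNReal.ofReal_toReal (hnt x)
  by_cases hM0 : ⨆ x, f x = 0
  · have : ∀ x, f x = 0 := by simpa using hM0
    simp [this]
  by_cases hN0 : ⨆ x, g x = 0
  · have : ∀ x, g x = 0 := by simpa using hN0
    simp [this]
  obtain ⟨φ, φm, φ0, φ1, φs, φe⟩ := key f hf _ rfl fb hM0
  obtain ⟨ψ, ψm, ψ0, ψ1, ψs, ψe⟩ := key g hg _ rfl gb hN0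
  set M := ⨆ x, f x with hM
  set N := ⨆ x, g x with hN
  set S : ℝ≥0∞ := (M * N) ^ (1 / 2 : ℝ) with hS
  have hS2 : S ^ 2 = M * N := by
    rw [hS, ← ENNReal.rpow_natCast, ← ENNReal.rpow_mul]; norm_num
  have hMN0 : M * N ≠ 0 := mul_ne_zero hM0 hN0
  have hMNt : M * N ≠ ⊤ := ENNReal.mul_ne_top fb gb
  have hS0 : S ≠ 0 := by
    intro h; rw [h] at hS2; simp at hS2; exact hS2.elim hM0 hN0
  have hSt : S ≠ ⊤ := by
    intro h; rw [h] at hS2; exact hMNt (by rw [← hS2]; simp)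
  let χ : ℝ → ℝ := fun x => (min (h x / S) 1).toReal
  have χe : ∀ x, ENNReal.ofReal (χ x) = min (h x / S) 1 := fun x =>
    ENNReal.ofReal_toReal (ne_top_of_le_ne_top ENNReal.one_ne_top (min_le_right _ _))
  have hχ := pl_real_unit φ ψ χ φm ψm ((hh.div_const S).min measurable_const).ennreal_toReal
    φ0 ψ0 (fun x => by simp [χ]) φ1 ψ1 φs ψs (by
      intro x y
      have h2 : ENNReal.ofReal (φ x) * ENNReal.ofReal (ψ y)
          ≤ ENNReal.ofReal (χ ((1 / 2 : ℝ) • (x + y))) ^ 2 := by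
        rw [χe]
        rcases le_total (h ((1 / 2 : ℝ) • (x + y)) / S) 1 with h3 | h3
        · rw [min_eq_left h3, φe, ψe, ENNReal.div_eq_inv_mul, ENNReal.div_eq_inv_mul,
            ENNReal.div_eq_inv_mul, mul_pow, ← ENNReal.inv_pow, hS2,
            ENNReal.mul_inv (Or.inl hM0) (Or.inl fb)]
          calc _ = (M⁻¹ * N⁻¹) * (f x * g y) := by ring
            _ ≤ _ := by gcongr; exact H x y
        · rw [min_eq_right h3]
          calc _ ≤ (1 : ℝ≥0∞) * 1 := by
                gcongr
                · simpa using φ1 x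
                · simpa using ψ1 y
            _ = _ := by simp
      rw [← ENNReal.ofReal_mul (φ0 x), ← ENNReal.ofReal_pow (by simp [χ])] at h2
      exact (ENNReal.ofReal_le_ofReal_iff (by positivity)).1 h2)
  have h4 := ennreal_amgm hχ
  simp only [φe, ψe, χe] at h4
  have e1 : ∫⁻ x, f x = M * ∫⁻ x, f x / M := by
    rw [← lintegral_const_mul' _ _ fb]
    exact lintegral_congr fun x => (ENNReal.mul_div_cancel hM0 fb).symm
  have e2 : ∫⁻ x, g x = N * ∫⁻ x, g x / N := by
    rw [← lintegral_const_mul' _ _ gb]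
    exact lintegral_congr fun x => (ENNReal.mul_div_cancel hN0 gb).symm
  have e3 : S * ∫⁻ x, min (h x / S) 1 ≤ ∫⁻ x, h x := by
    rw [← lintegral_const_mul' _ _ hSt]
    refine lintegral_mono fun x => ?_
    calc S * min (h x / S) 1 ≤ S * (h x / S) := by gcongr; exact min_le_left _ _
      _ = h x := ENNReal.mul_div_cancel hS0 hSt
  calc (∫⁻ x, f x) * (∫⁻ x, g x) = (M * N) * ((∫⁻ x, f x / M) * ∫⁻ x, g x / N) := by
        rw [e1, e2]; ring
    _ ≤ S ^ 2 * (∫⁻ x, min (h x / S) 1) ^ 2 := by rw [hS2]; gcongr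
    _ = (S * ∫⁻ x, min (h x / S) 1) ^ 2 := by ring
    _ ≤ _ := by gcongr

theorem lintegral_trunc (f : ℝ → ℝ≥0∞) (hf : Measurable f) :
    ∫⁻ x, f x = ⨆ n : ℕ, ∫⁻ x, min (f x) n := by
  rw [← lintegral_iSup (fun n => hf.min measurable_const)]
  · refine lintegral_congr fun x => ?_
    have := inf_iSup_eq (f x) (fun n : ℕ => (n : ℝ≥0∞))
    rw [ENNReal.iSup_natCast] at this
    simpa using this
  · intro m n hmn x
    exact min_le_min le_rfl (by exact_mod_cast hmn)

theorem pl_real : PLProp (volume : Measure ℝ) := by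
  intro f g h hf hg hh H
  rw [lintegral_trunc f hf, lintegral_trunc g hg, ENNReal.iSup_mul]
  refine iSup_le fun m => ?_
  rw [ENNReal.mul_iSup]
  refine iSup_le fun n => ?_
  refine pl_real_bdd _ _ h (hf.min measurable_const) (hg.min measurable_const) hh
    (ne_top_of_le_ne_top (ENNReal.natCast_ne_top m) (iSup_le fun x => min_le_right _ _))
    (ne_top_of_le_ne_top (ENNReal.natCast_ne_top n) (iSup_le fun x => min_le_right _ _)) ?_
  intro x y
  exact le_trans (mul_le_mul' (min_le_left _ _) (min_le_left _ _)) (H x y)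

theorem pl_prod {E F : Type*} [AddCommGroup E] [Module ℝ E] [MeasurableSpace E]
    [AddCommGroup F] [Module ℝ F] [MeasurableSpace F] (μ : Measure E) (ν : Measure F)
    [SFinite μ] [SFinite ν] (hμ : PLProp μ) (hν : PLProp ν) : PLProp (μ.prod ν) := by
  intro f g h hf hg hh H
  rw [lintegral_prod _ hf.aemeasurable, lintegral_prod _ hg.aemeasurable,
    lintegral_prod _ hh.aemeasurable]
  refine hμ _ _ _ hf.lintegral_prod_right' hg.lintegral_prod_right' hh.lintegral_prod_right' ?_
  intro x y
  refine hν _ _ _ (hf.comp measurable_prodMk_left) (hg.comp measurable_prodMk_left)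
    (hh.comp measurable_prodMk_left) ?_
  intro u v
  exact H (x, u) (y, v)

theorem pl_map {E F : Type*} [AddCommGroup E] [Module ℝ E] [MeasurableSpace E]
    [AddCommGroup F] [Module ℝ F] [MeasurableSpace F] (μ : Measure E) (ν : Measure F)
    (T : E →ₗ[ℝ] F) (hT : MeasurePreserving T μ ν) (hμ : PLProp μ) : PLProp ν := by
  intro f g h hf hg hh H
  rw [← hT.lintegral_comp hf, ← hT.lintegral_comp hg, ← hT.lintegral_comp hh]
  refine hμ _ _ _ (hf.comp hT.measurable) (hg.comp hT.measurable) (hh.comp hT.measurable) ?_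
  intro x y
  simpa using H (T x) (T y)

theorem pl_smul {E : Type*} [AddCommGroup E] [Module ℝ E] [MeasurableSpace E]
    (μ : Measure E) (c : NNReal) (hμ : PLProp μ) : PLProp (c • μ) := by
  intro f g h hf hg hh H
  have := hμ f g h hf hg hh H
  simp only [lintegral_smul_measure, ENNReal.smul_def, smul_eq_mul]
  calc _ = (c : ℝ≥0∞) ^ 2 * ((∫⁻ x, f x ∂μ) * (∫⁻ x, g x ∂μ)) := by ring
    _ ≤ (c : ℝ≥0∞) ^ 2 * (∫⁻ x, h x ∂μ) ^ 2 := by gcongr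
    _ = _ := by ring

theorem pl_pi (n : ℕ) : PLProp (volume : Measure (Fin n → ℝ)) := by
  induction n with
  | zero =>
    intro f g h hf hg hh H
    rw [volume_pi, Measure.pi_of_empty _ (0 : Fin 0 → ℝ)]
    rw [lintegral_dirac, lintegral_dirac, lintegral_dirac]
    simpa using H 0 0
  | succ n ih =>
    let T : (ℝ × (Fin n → ℝ)) →ₗ[ℝ] (Fin (n + 1) → ℝ) :=
      { toFun := (MeasurableEquiv.piFinSuccAbove (fun _ : Fin (n + 1) => ℝ) 0).symm
        map_add' := by
          rintro ⟨x, u⟩ ⟨y, v⟩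
          ext i
          refine Fin.cases ?_ (fun j => ?_) i <;>
            simp [MeasurableEquiv.piFinSuccAbove_symm_apply, Fin.insertNthEquiv]
        map_smul' := by
          rintro c ⟨x, u⟩
          ext i
          refine Fin.cases ?_ (fun j => ?_) i <;>
            simp [MeasurableEquiv.piFinSuccAbove_symm_apply, Fin.insertNthEquiv] }
    exact pl_map _ _ T ((volume_preserving_piFinSuccAbove (fun _ : Fin (n + 1) => ℝ) 0).symm _)
      (pl_prod _ _ pl_real ih)

theorem pl_haar (V : Type*) [NormedAddCommGroup V] [NormedSpace ℝ V]
    [FiniteDimensional ℝ V] [MeasurableSpace V] [BorelSpace V]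
    (μ : Measure V) [μ.IsAddHaarMeasure] : PLProp μ := by
  let e : (Fin (Module.finrank ℝ V) → ℝ) ≃L[ℝ] V :=
    ContinuousLinearEquiv.ofFinrankEq (by simp)
  have : ((volume : Measure (Fin (Module.finrank ℝ V) → ℝ)).map e).IsAddHaarMeasure :=
    e.isAddHaarMeasure_map _
  rw [Measure.isAddLeftInvariant_eq_smul μ (volume.map e)]
  exact pl_smul _ _ (pl_map volume _ (e : (Fin (Module.finrank ℝ V) → ℝ) →ₗ[ℝ] V)
    ⟨e.continuous.measurable, rfl⟩ (pl_pi _))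

/-- **isodiametric inequality in normed spaces.** In a
finite-dimensional real normed vector space with a Haar measure `μ`, every set of
diameter at most `2` has measure at most that of the closed unit ball: the unit
ball is isodiametric. -/
theorem statement_8 (V : Type*) [NormedAddCommGroup V] [NormedSpace ℝ V]
    [FiniteDimensional ℝ V] [MeasurableSpace V] [BorelSpace V]
    (μ : Measure V) [μ.IsAddHaarMeasure]
    (A : Set V) (hA : EMetric.diam A ≤ 2) :
    μ A ≤ μ (Metric.closedBall 0 1) := by
  refine le_trans (measure_mono (subset_closure (s := A))) ?_
  have hB : Metric.ediam (closure A) ≤ 2 := by rw [Metric.ediam_closure]; exact hA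
  have hm : MeasurableSet (closure A) := isClosed_closure.measurableSet
  set B := closure A
  have key := pl_haar V μ (B.indicator 1) ((-B).indicator 1) ((Metric.closedBall 0 1).indicator 1)
    (measurable_one.indicator hm) (measurable_one.indicator hm.neg)
    (measurable_one.indicator Metric.isClosed_closedBall.measurableSet) (by
      intro x y
      by_cases hx : x ∈ B
      · by_cases hy : y ∈ -B
        · have hd : edist x (-y) ≤ 2 := le_trans (Metric.edist_le_ediam_of_mem hx hy) hB
          have hd' : ‖x + y‖ ≤ 2 := by
            rw [edist_dist, dist_eq_norm, sub_neg_eq_add] at hd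
            exact (ENNReal.ofReal_le_ofReal_iff (by norm_num)).1 (by simpa using hd)
          have hz : (1 / 2 : ℝ) • (x + y) ∈ Metric.closedBall (0 : V) 1 := by
            rw [mem_closedBall_zero_iff, norm_smul]
            norm_num
            linarith
          rw [Set.indicator_of_mem hx, Set.indicator_of_mem hy, Set.indicator_of_mem hz]
          simp
        · simp [Set.indicator_of_notMem hy]
      · simp [Set.indicator_of_notMem hx])
  rw [lintegral_indicator_one hm, lintegral_indicator_one hm.neg,
    lintegral_indicator_one Metric.isClosed_closedBall.measurableSet, Measure.measure_neg,
    ← pow_two] at key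
  exact (ENNReal.pow_le_pow_left_iff (by norm_num)).1 key
end

section
/- Let V be a real normed vector space of finite dimension n ≥ 1, regarded as a metric space with the norm-induced distance. Then for every x ∈ V, lim_{r→0} H^n(B̄(x,r))/(2r)^n = 1, where B̄(x,r) is the closed ball and H^n is the n-dimensional Hausdorff measure of V. -/
open MeasureTheory Filter
open scoped ENNReal

namespace Iso

open scoped Pointwise

/-- One-dimensional Brunn-Minkowski inequality for midpoints of compact sets. -/
lemma one_dim_compact (A B : Set ℝ) (hA : IsCompact A) (hB : IsCompact B)
    (hA0 : A.Nonempty) (hB0 : B.Nonempty) (C : Set ℝ)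
    (h : ∀ a ∈ A, ∀ b ∈ B, (a + b) / 2 ∈ C) :
    volume A + volume B ≤ 2 * volume C := by
  obtain ⟨a, haA, ha⟩ := hA.exists_isGreatest hA0
  obtain ⟨b, hbB, hb⟩ := hB.exists_isLeast hB0
  -- the affine images of A and B inside C
  let A' : Set ℝ := (fun x => x + b) '' A
  let B' : Set ℝ := (fun x => x + a) '' B
  have hvA : volume A' = volume A := by
    simp only [A', Set.image_add_right, measure_preimage_add_right]
  have hvB : volume B' = volume B := by
    simp only [B', Set.image_add_right, measure_preimage_add_right]
  have hA'm : MeasurableSet A' := (hA.image (by fun_prop)).measurableSet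
  have hsub : A' ∪ B' ⊆ (fun x => (2:ℝ) * x) '' C := by
    rintro x (⟨y, hy, rfl⟩ | ⟨y, hy, rfl⟩)
    · exact ⟨_, h y hy b hbB, by ring⟩
    · exact ⟨_, h a haA y hy, by ring⟩
  have hint : A' ∩ B' ⊆ {a + b} := by
    rintro x ⟨⟨y, hy, rfl⟩, ⟨z, hz, hzy⟩⟩
    have h1 := ha hy
    have h2 := hb hz
    simp only [Set.mem_singleton_iff] at *
    linarith
  have hint0 : volume (A' ∩ B') = 0 := measure_mono_null hint (by simp)
  have hu := measure_union_add_inter' hA'm B' (μ := volume)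
  rw [hint0, add_zero, hvA, hvB] at hu
  rw [← hu]
  refine (measure_mono hsub).trans ?_
  have : (fun x => (2:ℝ) * x) '' C = (2:ℝ) • C := rfl
  rw [this, Measure.addHaar_smul]
  simp

lemma one_dim (A B : Set ℝ) (hA : MeasurableSet A) (hB : MeasurableSet B)
    (hA0 : A.Nonempty) (hB0 : B.Nonempty) (C : Set ℝ)
    (h : ∀ a ∈ A, ∀ b ∈ B, (a + b) / 2 ∈ C) :
    volume A + volume B ≤ 2 * volume C := by
  obtain ⟨a, ha⟩ := hA0
  obtain ⟨b, hb⟩ := hB0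
  have e : ∀ D : Set ℝ, MeasurableSet D →
      volume D = ⨆ (K : Set ℝ) (_ : K ⊆ D ∧ IsCompact K), volume K := by
    intro D hD
    rw [hD.measure_eq_iSup_isCompact]
    simp only [iSup_and]
  rw [e A hA, e B hB]
  refine ENNReal.biSup_add_biSup_le' (p := fun K => K ⊆ A ∧ IsCompact K)
    (q := fun K => K ⊆ B ∧ IsCompact K) ⟨∅, by simp⟩ ⟨∅, by simp⟩ fun K hK L hL => ?_
  refine le_trans ?_ (one_dim_compact (insert a K) (insert b L) (hK.2.insert a) (hL.2.insert b)
    (Set.insert_nonempty _ _) (Set.insert_nonempty _ _) C ?_)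
  · gcongr <;> exact Set.subset_insert _ _
  · exact fun x hx y hy => h x (Set.insert_subset ha hK.1 hx) y (Set.insert_subset hb hL.1 hy)

lemma normalized (f g h : ℝ → ℝ) (hf : Measurable f) (hg : Measurable g) (hh : Measurable h)
    (f0 : ∀ x, 0 ≤ f x) (g0 : ∀ x, 0 ≤ g x) (h0 : ∀ x, 0 ≤ h x)
    (f1 : ∀ x, f x ≤ 1) (g1 : ∀ x, g x ≤ 1)
    (fs : ∀ l < 1, ∃ x, l < f x) (gs : ∀ l < 1, ∃ x, l < g x)
    (H : ∀ s t, f s * g t ≤ h ((s + t) / 2) ^ 2) :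
    (∫⁻ x, ENNReal.ofReal (f x)) + (∫⁻ x, ENNReal.ofReal (g x))
      ≤ 2 * ∫⁻ x, ENNReal.ofReal (h x) := by
  rw [lintegral_eq_lintegral_meas_lt _ (ae_of_all _ f0) hf.aemeasurable,
    lintegral_eq_lintegral_meas_lt _ (ae_of_all _ g0) hg.aemeasurable,
    lintegral_eq_lintegral_meas_lt _ (ae_of_all _ h0) hh.aemeasurable,
    ← lintegral_const_mul' _ _ (by simp)]
  refine (le_lintegral_add _ _).trans ?_
  refine setLIntegral_mono' measurableSet_Ioi fun l hl => ?_
  rcases lt_or_ge l 1 with hl1 | hl1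
  · refine one_dim _ _ (measurableSet_lt measurable_const hf) (measurableSet_lt measurable_const hg)
      (fs l hl1) (gs l hl1) _ fun a ha b hb => ?_
    have hl' : (0:ℝ) < l := hl
    simp only [Set.mem_ofPred_eq] at *
    refine lt_of_pow_lt_pow_left₀ 2 (h0 _) (lt_of_lt_of_le ?_ (H a b))
    nlinarith
  · have e1 : {a | l < f a} = ∅ := by ext x; simpa using (f1 x).trans hl1
    have e2 : {a | l < g a} = ∅ := by ext x; simpa using (g1 x).trans hl1
    simp [e1, e2]

lemma amgm (a b c : ℝ≥0∞) (h : a + b ≤ 2 * c) : a * b ≤ c ^ 2 := by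
  rcases eq_or_ne c ⊤ with rfl | hc
  · simp
  have hab : a + b ≠ ⊤ := ne_top_of_le_ne_top (by finiteness) h
  have ha : a ≠ ⊤ := ne_top_of_le_ne_top hab le_self_add
  have hb : b ≠ ⊤ := ne_top_of_le_ne_top hab le_add_self
  lift a to NNReal using ha
  lift b to NNReal using hb
  lift c to NNReal using hc
  norm_cast at *
  have h' : (a:ℝ) + b ≤ 2 * c := by exact_mod_cast h
  have : (a:ℝ) * b ≤ c ^ 2 := by
    nlinarith [sq_nonneg ((a:ℝ) - b), a.2, b.2, c.2, NNReal.coe_nonneg a, NNReal.coe_nonneg b]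
  exact_mod_cast this

/-- One-dimensional Prekopa-Leindler inequality with exponent one half. -/
lemma prekopa (f g h : ℝ → ℝ) (hf : Measurable f) (hg : Measurable g) (hh : Measurable h)
    (f0 : ∀ x, 0 ≤ f x) (g0 : ∀ x, 0 ≤ g x) (h0 : ∀ x, 0 ≤ h x)
    (f1 : BddAbove (Set.range f)) (g1 : BddAbove (Set.range g))
    (H : ∀ s t, f s * g t ≤ h ((s + t) / 2) ^ 2) :
    (∫⁻ x, ENNReal.ofReal (f x)) * (∫⁻ x, ENNReal.ofReal (g x))
      ≤ (∫⁻ x, ENNReal.ofReal (h x)) ^ 2 := by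
  by_cases hfz : ∀ x, f x = 0
  · simp [hfz]
  by_cases hgz : ∀ x, g x = 0
  · simp [hgz]
  push Not at hfz hgz
  obtain ⟨x₀, hx₀⟩ := hfz
  obtain ⟨y₀, hy₀⟩ := hgz
  set F := ⨆ x, f x with hF
  set G := ⨆ x, g x with hG
  have F0 : 0 < F := lt_of_lt_of_le (lt_of_le_of_ne (f0 x₀) hx₀.symm) (le_ciSup f1 x₀)
  have G0 : 0 < G := lt_of_lt_of_le (lt_of_le_of_ne (g0 y₀) hy₀.symm) (le_ciSup g1 y₀)
  have key := normalized (fun x => f x / F) (fun x => g x / G) (fun x => h x / √(F * G))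
    (by fun_prop) (by fun_prop) (by fun_prop) (fun x => div_nonneg (f0 x) F0.le)
    (fun x => div_nonneg (g0 x) G0.le) (fun x => div_nonneg (h0 x) (by positivity))
    (fun x => (div_le_one F0).2 (le_ciSup f1 x)) (fun x => (div_le_one G0).2 (le_ciSup g1 x))
    (fun l hl => by
      obtain ⟨x, hx⟩ := exists_lt_of_lt_ciSup (show l * F < ⨆ x, f x by rw [← hF]; nlinarith)
      exact ⟨x, (lt_div_iff₀ F0).2 hx⟩)
    (fun l hl => by
      obtain ⟨x, hx⟩ := exists_lt_of_lt_ciSup (show l * G < ⨆ x, g x by rw [← hG]; nlinarith)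
      exact ⟨x, (lt_div_iff₀ G0).2 hx⟩)
    (fun s t => by
      rw [div_pow, Real.sq_sqrt (by positivity), div_mul_div_comm]
      gcongr
      exact H s t)
  have key2 := amgm _ _ _ key
  have e1 : ∫⁻ x, ENNReal.ofReal (f x) = ENNReal.ofReal F * ∫⁻ x, ENNReal.ofReal (f x / F) := by
    rw [← lintegral_const_mul' _ _ (by simp)]
    congr with x
    rw [← ENNReal.ofReal_mul F0.le, mul_div_cancel₀ _ F0.ne']
  have e2 : ∫⁻ x, ENNReal.ofReal (g x) = ENNReal.ofReal G * ∫⁻ x, ENNReal.ofReal (g x / G) := by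
    rw [← lintegral_const_mul' _ _ (by simp)]
    congr with x
    rw [← ENNReal.ofReal_mul G0.le, mul_div_cancel₀ _ G0.ne']
  have S0 : 0 < √(F * G) := by positivity
  have e3 : ∫⁻ x, ENNReal.ofReal (h x)
      = ENNReal.ofReal √(F * G) * ∫⁻ x, ENNReal.ofReal (h x / √(F * G)) := by
    rw [← lintegral_const_mul' _ _ (by simp)]
    congr with x
    rw [← ENNReal.ofReal_mul S0.le, mul_div_cancel₀ _ S0.ne']
  rw [e1, e2, e3, mul_mul_mul_comm, mul_pow, ← ENNReal.ofReal_mul F0.le,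
    ← ENNReal.ofReal_pow S0.le, Real.sq_sqrt (by positivity)]
  gcongr

/-- Midpoint form of the (multiplicative) Brunn-Minkowski inequality. -/
def BM (E : Type*) [NormedAddCommGroup E] [NormedSpace ℝ E] [MeasurableSpace E]
    (μ : Measure E) : Prop :=
  ∀ A B C : Set E, IsCompact A → IsCompact B → IsCompact C →
    (∀ a ∈ A, ∀ b ∈ B, (1 / 2 : ℝ) • (a + b) ∈ C) → μ A * μ B ≤ μ C ^ 2

lemma slice_compact {E : Type*} [NormedAddCommGroup E] {A : Set (ℝ × E)} (hA : IsCompact A)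
    (s : ℝ) : IsCompact (Prod.mk s ⁻¹' A) :=
  (hA.image continuous_snd).of_isClosed_subset (hA.isClosed.preimage (by fun_prop))
    fun x hx => ⟨(s, x), hx, rfl⟩

lemma BM.prod {E : Type*} [NormedAddCommGroup E] [NormedSpace ℝ E] [MeasurableSpace E]
    [BorelSpace E] [SecondCountableTopology E]
    (μ : Measure E) [SigmaFinite μ] [IsFiniteMeasureOnCompacts μ] (h : BM E μ) :
    BM (ℝ × E) ((volume : Measure ℝ).prod μ) := by
  intro A B C hA hB hC H
  have hfin : ∀ {D : Set (ℝ × E)}, IsCompact D → ∀ s, μ (Prod.mk s ⁻¹' D) ≠ ⊤ :=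
    fun hD s => (slice_compact hD s).measure_lt_top.ne
  have hmeas : ∀ {D : Set (ℝ × E)}, IsCompact D →
      Measurable fun s => (μ (Prod.mk s ⁻¹' D)).toReal :=
    fun hD => (measurable_measure_prodMk_left hD.measurableSet).ennreal_toReal
  have hbdd : ∀ {D : Set (ℝ × E)}, IsCompact D →
      BddAbove (Set.range fun s => (μ (Prod.mk s ⁻¹' D)).toReal) := by
    intro D hD
    refine ⟨(μ (Prod.snd '' D)).toReal, ?_⟩
    rintro _ ⟨s, rfl⟩
    exact ENNReal.toReal_mono (hD.image continuous_snd).measure_lt_top.ne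
      (measure_mono fun x hx => ⟨(s, x), hx, rfl⟩)
  have heq : ∀ {D : Set (ℝ × E)}, IsCompact D → ((volume : Measure ℝ).prod μ) D =
      ∫⁻ s, ENNReal.ofReal (μ (Prod.mk s ⁻¹' D)).toReal := by
    intro D hD
    rw [Measure.prod_apply hD.measurableSet]
    congr with s
    rw [ENNReal.ofReal_toReal (hfin hD s)]
  rw [heq hA, heq hB, heq hC]
  refine prekopa _ _ _ (hmeas hA) (hmeas hB) (hmeas hC) (fun _ => ENNReal.toReal_nonneg)
    (fun _ => ENNReal.toReal_nonneg) (fun _ => ENNReal.toReal_nonneg) (hbdd hA) (hbdd hB)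
    fun s t => ?_
  rw [← ENNReal.toReal_mul, ← ENNReal.toReal_pow]
  refine ENNReal.toReal_mono (ENNReal.pow_ne_top (hfin hC _)) ?_
  refine h _ _ _ (slice_compact hA s) (slice_compact hB t) (slice_compact hC _) ?_
  intro a ha b hb
  have := H _ ha _ hb
  simp only [Prod.mk_add_mk, Prod.smul_mk, smul_eq_mul] at this
  rw [show 1 / 2 * (s + t) = (s + t) / 2 by ring] at this
  exact this

lemma BM.transfer {V W : Type*} [NormedAddCommGroup V] [NormedSpace ℝ V] [MeasurableSpace V]
    [BorelSpace V] [NormedAddCommGroup W] [NormedSpace ℝ W] [MeasurableSpace W]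
    [BorelSpace W] [FiniteDimensional ℝ V] [FiniteDimensional ℝ W]
    (e : V ≃L[ℝ] W) (μ : Measure V) [μ.IsAddHaarMeasure] (ν : Measure W) [ν.IsAddHaarMeasure]
    (h : BM W ν) : BM V μ := by
  intro A B C hA hB hC H
  have hc := Measure.isAddLeftInvariant_eq_smul (μ.map e) ν
  set c := (μ.map e).addHaarScalarFactor ν
  have key : ∀ D : Set V, IsCompact D → μ D = c * ν (e '' D) := by
    intro D hD
    have h1 : μ.map e (e '' D) = μ D := by
      rw [Measure.map_apply e.continuous.measurable (hD.image e.continuous).measurableSet,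
        Set.preimage_image_eq _ e.injective]
    rw [← h1, hc]
    rfl
  rw [key A hA, key B hB, key C hC, mul_pow, mul_mul_mul_comm, ← sq]
  gcongr
  refine h _ _ _ (hA.image e.continuous) (hB.image e.continuous) (hC.image e.continuous) ?_
  rintro _ ⟨a, ha, rfl⟩ _ ⟨b, hb, rfl⟩
  exact ⟨_, H a ha b hb, by simp⟩

lemma BM.pi (n : ℕ) : BM (Fin n → ℝ) volume := by
  induction n with
  | zero =>
    intro A B C hA hB hC H
    rcases A.eq_empty_or_nonempty with rfl | ⟨a, ha⟩
    · simp
    rcases B.eq_empty_or_nonempty with rfl | ⟨b, hb⟩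
    · simp
    have hall : ∀ (D : Set (Fin 0 → ℝ)) (x : Fin 0 → ℝ), x ∈ D → D = Set.univ := fun D x hx =>
      Set.eq_univ_of_forall fun y => Subsingleton.elim x y ▸ hx
    rw [hall A a ha, hall B b hb, hall C _ (H a ha b hb), sq]
  | succ n ih =>
    have e : (Fin (n + 1) → ℝ) ≃L[ℝ] ℝ × (Fin n → ℝ) :=
      ContinuousLinearEquiv.ofFinrankEq (by simp [add_comm])
    exact BM.transfer e volume _ (BM.prod volume ih)

lemma BM.general (V : Type*) [NormedAddCommGroup V] [NormedSpace ℝ V]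
    [FiniteDimensional ℝ V] [MeasurableSpace V] [BorelSpace V] (μ : Measure V)
    [μ.IsAddHaarMeasure] : BM V μ :=
  BM.transfer (W := Fin (Module.finrank ℝ V) → ℝ) (ContinuousLinearEquiv.ofFinrankEq (by simp))
    μ volume (BM.pi _)

/-- Isodiametric inequality. -/
lemma isodiam (V : Type*) [NormedAddCommGroup V] [NormedSpace ℝ V]
    [FiniteDimensional ℝ V] [MeasurableSpace V] [BorelSpace V] (μ : Measure V)
    [μ.IsAddHaarMeasure] (S : Set V) (hS : Bornology.IsBounded S) :
    μ S ≤ μ (Metric.closedBall 0 (Metric.diam S / 2)) := by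
  set K := closure S with hK
  have hKc : IsCompact K := hS.isCompact_closure
  have hd : Metric.diam K = Metric.diam S := Metric.diam_closure S
  refine (measure_mono subset_closure).trans ?_
  have := BM.general V μ K (-K) (Metric.closedBall 0 (Metric.diam S / 2)) hKc hKc.neg
    (isCompact_closedBall _ _) (by
      intro a ha b hb
      have := Metric.dist_le_diam_of_mem hKc.isBounded ha (Set.mem_neg.1 hb)
      rw [dist_eq_norm, sub_neg_eq_add, hd] at this
      rw [mem_closedBall_zero_iff, norm_smul]
      norm_num
      linarith)
  rw [Measure.measure_neg, ← sq] at this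
  exact (ENNReal.pow_le_pow_left_iff two_ne_zero).1 this

lemma lower (V : Type*) [NormedAddCommGroup V] [NormedSpace ℝ V]
    [FiniteDimensional ℝ V] [MeasurableSpace V] [BorelSpace V] :
    2 ^ (Module.finrank ℝ V) ≤ μH[(Module.finrank ℝ V : ℝ)] (Metric.ball (0 : V) 1) := by
  set n := Module.finrank ℝ V with hnn
  set μ : Measure V := μH[(n : ℝ)] with hμ
  have : μ.IsAddHaarMeasure := by rw [hμ]; infer_instance
  set b := μ (Metric.ball (0 : V) 1) with hb
  have b0 : b ≠ 0 := (Metric.measure_ball_pos μ _ one_pos).ne'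
  have bt : b ≠ ⊤ := measure_ball_lt_top.ne
  have key : (2 ^ n / b) • μ ≤ μH[(n : ℝ)] := by
    refine Measure.le_hausdorffMeasure _ _ 1 one_pos fun S hS => ?_
    have hSb : Bornology.IsBounded S :=
      Metric.isBounded_iff_ediam_ne_top.2 (ne_top_of_le_ne_top (by simp) hS)
    have h1 := isodiam V μ S hSb
    rw [Measure.addHaar_closedBall μ _ (by positivity)] at h1
    rw [Measure.smul_apply, smul_eq_mul]
    refine (mul_le_mul_right h1 _).trans (le_of_eq ?_)
    rw [← hb, ← hnn, mul_comm, mul_assoc, ENNReal.mul_div_cancel b0 bt,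
      ENNReal.rpow_natCast, ENNReal.ofReal_pow (by positivity), ← mul_pow]
    congr 1
    rw [← ENNReal.ofReal_ofNat 2, ← ENNReal.ofReal_mul (by positivity), div_mul_cancel₀ _ two_ne_zero,
      Metric.diam, ENNReal.ofReal_toReal (ne_top_of_le_ne_top (by simp) hS)]
  have := key (Metric.ball (0 : V) 1)
  rwa [Measure.smul_apply, smul_eq_mul, ← hb, ENNReal.div_mul_cancel b0 bt] at this

lemma upper (V : Type*) [NormedAddCommGroup V] [NormedSpace ℝ V]
    [FiniteDimensional ℝ V] [MeasurableSpace V] [BorelSpace V] :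
    μH[(Module.finrank ℝ V : ℝ)] (Metric.ball (0 : V) 1) ≤ 2 ^ (Module.finrank ℝ V) := by
  set n := Module.finrank ℝ V with hnn
  set μ : Measure V := μH[(n : ℝ)] with hμ
  have : μ.IsAddHaarMeasure := by rw [hμ]; infer_instance
  set b := μ (Metric.ball (0 : V) 1) with hb
  have b0 : b ≠ 0 := (Metric.measure_ball_pos μ _ one_pos).ne'
  have bt : b ≠ ⊤ := measure_ball_lt_top.ne
  have cover : ∀ k : ℕ, ∃ (t : Set V) (r : V → ℝ), t.Countable ∧ t ⊆ Metric.ball (0 : V) 1 ∧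
      (∀ x ∈ t, r x ∈ {ρ : ℝ | Metric.closedBall x ρ ⊆ Metric.ball 0 1} ∩
        Set.Ioo 0 (1 / ((k : ℝ) + 1))) ∧
      μ (Metric.ball (0 : V) 1 \ ⋃ x ∈ t, Metric.closedBall x (r x)) = 0 ∧
        t.PairwiseDisjoint fun x => Metric.closedBall x (r x) := by
    intro k
    refine Besicovitch.exists_disjoint_closedBall_covering_ae μ
      (fun x => {ρ : ℝ | Metric.closedBall x ρ ⊆ Metric.ball 0 1}) _ ?_
      (fun _ => 1 / ((k : ℝ) + 1)) (fun _ _ => by positivity)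
    intro x hx δ hδ
    obtain ⟨ε, hε, hsub⟩ := Metric.nhds_basis_closedBall.mem_iff.1 (Metric.isOpen_ball.mem_nhds hx)
    refine ⟨min ε (δ / 2), (Metric.closedBall_subset_closedBall (min_le_left _ _)).trans hsub,
      by positivity, lt_of_le_of_lt (min_le_right _ _) (by linarith)⟩
  choose t r tc ts hr hnull hdisj using cover
  have hsum : ∀ k, ∑' x : t k, Metric.ediam (Metric.closedBall (x : V) (r k x)) ^ (n : ℝ) ≤ 2 ^ n := by
    intro k
    have := (tc k).to_subtype
    have h1 : ∀ x : t k, Metric.ediam (Metric.closedBall (x : V) (r k x)) ^ (n : ℝ)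
        ≤ 2 ^ n / b * μ (Metric.closedBall (x : V) (r k x)) := by
      intro x
      have hr0 : 0 ≤ r k x := (hr k x x.2).2.1.le
      rw [Measure.addHaar_closedBall μ _ hr0, ← hb, ← hnn, mul_comm, mul_assoc,
        ENNReal.mul_div_cancel b0 bt, ENNReal.rpow_natCast, ENNReal.ofReal_pow hr0, ← mul_pow]
      gcongr
      rw [← Metric.closedEBall_ofReal hr0]
      exact Metric.ediam_closedEBall_le.trans (by rw [mul_comm])
    refine (ENNReal.tsum_le_tsum h1).trans ?_
    rw [ENNReal.tsum_mul_left]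
    rw [← measure_iUnion (f := fun x : t k => Metric.closedBall (x : V) (r k x))
      (fun x y hxy => hdisj k x.2 y.2 (fun h => hxy (Subtype.ext h)))
      (fun x => Metric.isClosed_closedBall.measurableSet)]
    calc _ ≤ 2 ^ n / b * b := by
          gcongr
          exact measure_mono (Set.iUnion_subset fun x : t k => (hr k x.1 x.2).1)
      _ = _ := ENNReal.div_mul_cancel b0 bt
  set s' : Set V := Metric.ball (0 : V) 1 ∩ ⋂ k, ⋃ x : t k, Metric.closedBall (x : V) (r k x)
    with hs'
  have hs : b ≤ μ s' := by
    have : μ (Metric.ball (0 : V) 1 \ s') = 0 := by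
      rw [hs', Set.sdiff_self_inter, Set.sdiff_iInter, measure_iUnion_null_iff]
      intro k
      rw [Set.iUnion_coe_set]
      exact hnull k
    calc b ≤ μ (s' ∪ (Metric.ball (0 : V) 1 \ s')) := measure_mono (by
            rw [Set.union_sdiff_self]; exact Set.subset_union_right)
      _ ≤ μ s' + μ (Metric.ball (0 : V) 1 \ s') := measure_union_le _ _
      _ = μ s' := by rw [this, add_zero]
  refine hs.trans ?_
  have : ∀ k, Countable (t k) := fun k => (tc k).to_subtype
  refine (Measure.hausdorffMeasure_le_liminf_tsum (n : ℝ) s' (l := atTop)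
    (fun k : ℕ => ENNReal.ofReal (2 * (1 / ((k : ℝ) + 1)))) ?_
    (fun k (x : t k) => Metric.closedBall (x : V) (r k x)) ?_ ?_).trans ?_
  · have := (tendsto_one_div_add_atTop_nhds_zero_nat (𝕜 := ℝ)).const_mul 2
    simpa using ENNReal.tendsto_ofReal this
  · refine Eventually.of_forall fun k x => ?_
    have hr0 := (hr k x x.2).2
    refine Metric.ediam_le_of_forall_dist_le fun y hy z hz => ?_
    have := dist_triangle_right y z x
    rw [Metric.mem_closedBall] at hy hz
    linarith [hr0.2]
  · exact Eventually.of_forall fun k => Set.inter_subset_right.trans (Set.iInter_subset _ k)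
  · exact (liminf_le_liminf (Eventually.of_forall hsum)).trans (by simp)

end Iso

/-- In a real normed vector space of finite dimension `n ≥ 1`, the
`n`-dimensional Hausdorff measure has density one at every point:
`ℋⁿ(B̄(x,r)) / (2r)ⁿ → 1` as `r → 0⁺`. Equivalently, the unit ball of a
finite-dimensional normed space is isodiametric. -/
theorem statement_9 (V : Type*) [NormedAddCommGroup V] [NormedSpace ℝ V]
    [FiniteDimensional ℝ V] [MeasurableSpace V] [BorelSpace V]
    (n : ℕ) (hn : 1 ≤ n) (hdim : Module.finrank ℝ V = n) (x : V) :
    Tendsto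
      (fun r : ℝ =>
        μH[(n : ℝ)] (Metric.closedBall x r) / ENNReal.ofReal (2 * r) ^ (n : ℝ))
      (nhdsWithin 0 (Set.Ioi 0)) (nhds 1) := by
  subst hdim
  refine tendsto_const_nhds.congr' ?_
  filter_upwards [self_mem_nhdsWithin] with r hr
  have hr0 : (0:ℝ) < r := hr
  rw [Measure.addHaar_closedBall _ _ hr0.le, le_antisymm (Iso.upper V) (Iso.lower V),
    ENNReal.rpow_natCast, ENNReal.ofReal_pow hr0.le, ← mul_pow, mul_comm 2 r,
    ENNReal.ofReal_mul hr0.le, ENNReal.ofReal_ofNat, ENNReal.div_self]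
  · exact pow_ne_zero _ (mul_ne_zero (by simpa using hr0) (by simp))
  · finiteness
end
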